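/- Let δ ≥ 0, let C > 100δ, and let C' ≥ 0. There exists a constant C₁ (depending only on δ, C and C') with the following property: whenever X is a geodesic metric space that is δ-hyperbolic in the sense of Gromov, φ₁ and φ₂ are isometries of X whose almost fixed sets F_C(φ₁) and F_C(φ₂) are nonempty and whose quasiconvex hulls 𝒳_C(φ₁) and 𝒳_C(φ₂) each have diameter at most C', and the distance between the sets 𝒳_C(φ₁) and 𝒳_C(φ₂) is at least C₁, then the group homomorphism from the free group on two generators to the isometry group of X sending the two generators to φ₁ and φ₂ respectively is injective; in particular the subgroup ⟨φ₁, φ₂⟩ of isometries of X is free of rank 2. -/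

import Mathlib

/-! Common definitions: geodesic segments, geodesic metric spaces, Gromov hyperbolicity,
almost fixed sets of isometries, quasiconvex hulls, set distance, quasiconvexity. -/

variable {X : Type*}

/-- `γ` is an arclength (isometric) parametrization of a geodesic from `x` to `y`,
defined on the interval `[0, dist x y]`. -/
def GeodesicParam [MetricSpace X] (γ : ℝ → X) (x y : X) : Prop :=
  γ 0 = x ∧ γ (dist x y) = y ∧
    ∀ s ∈ Set.Icc (0 : ℝ) (dist x y), ∀ t ∈ Set.Icc (0 : ℝ) (dist x y),
      dist (γ s) (γ t) = |s - t|

/-- `s` is a geodesic segment joining `x` to `y`. -/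
def IsGeodSegment [MetricSpace X] (s : Set X) (x y : X) : Prop :=
  ∃ γ : ℝ → X, GeodesicParam γ x y ∧ s = γ '' Set.Icc (0 : ℝ) (dist x y)

/-- A geodesic metric space: any two points are joined by a geodesic segment. -/
def IsGeodesicSpace (X : Type*) [MetricSpace X] : Prop :=
  ∀ x y : X, ∃ s : Set X, IsGeodSegment s x y

/-- The Gromov product `(x, y)_p`. -/
noncomputable def gromovProd [MetricSpace X] (p x y : X) : ℝ :=
  (dist p x + dist p y - dist x y) / 2

/-- `X` is δ-hyperbolic in the sense of Gromov: the Gromov product condition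
`(x, y)_p ≥ min ((x, z)_p, (z, y)_p) − δ` holds for all points. -/
def IsGromovHyperbolic (X : Type*) [MetricSpace X] (δ : ℝ) : Prop :=
  ∀ p x y z : X, min (gromovProd p x z) (gromovProd p z y) ≤ gromovProd p x y + δ

/-- The distance between two subsets of a metric space. -/
noncomputable def setDist [MetricSpace X] (A B : Set X) : ℝ :=
  sInf (Set.image2 dist A B)

/-- The almost fixed set `F_C(φ)` of an isometry `φ`. -/
def almostFixedSet [MetricSpace X] (φ : X ≃ᵢ X) (C : ℝ) : Set X :=
  {x | ∃ n : ℤ, n ≠ 0 ∧ dist x ((φ ^ n) x) ≤ C}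

/-- The quasiconvex hull `𝒳_C(φ)`: the union of all geodesic segments joining
pairs of points of the almost fixed set `F_C(φ)`. -/
def qcHull [MetricSpace X] (φ : X ≃ᵢ X) (C : ℝ) : Set X :=
  {y | ∃ p ∈ almostFixedSet φ C, ∃ q ∈ almostFixedSet φ C,
    ∃ s : Set X, IsGeodSegment s p q ∧ y ∈ s}

/-- `Y` is `c`-quasiconvex: every geodesic segment between points of `Y` lies in the
closed `c`-neighborhood of `Y`. -/
def IsQuasiconvexSet [MetricSpace X] (c : ℝ) (Y : Set X) : Prop :=
  ∀ p ∈ Y, ∀ q ∈ Y, ∀ s : Set X, IsGeodSegment s p q → ∀ y ∈ s, Metric.infDist y Y ≤ c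

/-- Ping-pong for cyclic subgroups, with a single ping-pong set per generator. -/
theorem FreeGroup.injective_lift_of_zpow_ping_pong {ι G α : Type*} [Nontrivial ι] [Group G]
    [MulAction G α] (a : ι → G) (S : ι → Set α) (hne : ∀ i, (S i).Nonempty)
    (hdisj : ∀ i j, i ≠ j → Disjoint (S i) (S j))
    (hpp : ∀ i j, i ≠ j → ∀ n : ℤ, n ≠ 0 → ∀ x ∈ S j, a i ^ n • x ∈ S i) :
    Function.Injective (FreeGroup.lift a) := by
  have hlift : FreeGroup.lift a =
      (Monoid.CoprodI.lift fun i => FreeGroup.lift fun _ : Unit => a i).comp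
        (freeGroupEquivCoprodI (ι := ι)).toMonoidHom := by
    ext i
    simp
  rw [hlift, MonoidHom.coe_comp]
  refine Function.Injective.comp ?_ (MulEquiv.injective freeGroupEquivCoprodI)
  refine Monoid.CoprodI.lift_injective_of_ping_pong
    (fun i => FreeGroup.lift fun _ : Unit => a i) ?_ S hne (fun i j hij => hdisj i j hij) ?_
  · inhabit ι
    right
    use default
    rw [FreeGroup.freeGroupUnitEquivInt.cardinal_eq, Cardinal.mk_denumerable]
    exact (Cardinal.natCast_lt_aleph0 (n := 3)).le
  · intro i j hij
    refine FreeGroup.freeGroupUnitEquivInt.forall_congr_left.mpr fun n hn => ?_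
    have hn0 : n ≠ 0 := by
      rintro rfl
      exact hn (by simp [FreeGroup.freeGroupUnitEquivInt])
    rintro _ ⟨x, hx, rfl⟩
    change FreeGroup.lift (fun _ => a i) (FreeGroup.of () ^ n) • x ∈ S i
    simpa only [map_zpow, FreeGroup.lift_apply_of] using hpp i j hij n hn0 x hx

section Hyperbolic

variable {X : Type*} [MetricSpace X]

theorem IsGromovHyperbolic.four_point {δ : ℝ} (h : IsGromovHyperbolic X δ) (p x y z : X) :
    dist p z + dist x y ≤ dist x z + dist p y + 2 * δ ∨
      dist p z + dist x y ≤ dist z y + dist p x + 2 * δ := by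
  have := h p x y z
  simp only [gromovProd] at this
  rcases min_le_iff.1 this with h | h
  · left; linarith
  · right; linarith

theorem IsGeodSegment.dist_add_dist {s : Set X} {x y z : X} (hs : IsGeodSegment s x y)
    (hz : z ∈ s) : dist x z + dist z y = dist x y := by
  obtain ⟨γ, ⟨h0, h1, hγ⟩, rfl⟩ := hs
  obtain ⟨t, ht, rfl⟩ := hz
  have hx := hγ 0 ⟨le_rfl, dist_nonneg⟩ t ht
  have hy := hγ t ht (dist x y) ⟨dist_nonneg, le_rfl⟩
  rw [h0, zero_sub, abs_neg, abs_of_nonneg ht.1] at hx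
  rw [h1, abs_of_nonpos (by linarith [ht.2])] at hy
  linarith

theorem IsGeodSegment.exists_dist_eq {s : Set X} {x y : X} (hs : IsGeodSegment s x y) {t : ℝ}
    (ht : 0 ≤ t) (ht' : t ≤ dist x y) :
    ∃ z ∈ s, dist x z = t ∧ dist z y = dist x y - t := by
  obtain ⟨γ, ⟨h0, h1, hγ⟩, rfl⟩ := hs
  have hx := hγ 0 ⟨le_rfl, dist_nonneg⟩ t ⟨ht, ht'⟩
  have hy := hγ t ⟨ht, ht'⟩ (dist x y) ⟨dist_nonneg, le_rfl⟩
  rw [h0, zero_sub, abs_neg, abs_of_nonneg ht] at hx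
  rw [h1, abs_of_nonpos (by linarith)] at hy
  exact ⟨γ t, ⟨t, ⟨ht, ht'⟩, rfl⟩, hx, by linarith⟩

theorem IsGeodSegment.image {s : Set X} {x y : X} (hs : IsGeodSegment s x y) (g : X ≃ᵢ X) :
    IsGeodSegment (g '' s) (g x) (g y) := by
  obtain ⟨γ, ⟨h0, h1, hγ⟩, rfl⟩ := hs
  refine ⟨g ∘ γ, ⟨by simp [h0], by simp only [g.dist_eq, Function.comp_apply, h1], ?_⟩, ?_⟩
  · simpa only [g.dist_eq, Function.comp_apply] using hγ
  · rw [g.dist_eq, Set.image_comp]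

theorem zpow_mem_almostFixedSet {φ : X ≃ᵢ X} {C : ℝ} {x : X} (hx : x ∈ almostFixedSet φ C)
    (n : ℤ) : (φ ^ n) x ∈ almostFixedSet φ C := by
  obtain ⟨k, hk, hd⟩ := hx
  refine ⟨k, hk, ?_⟩
  rwa [← IsometryEquiv.mul_apply, ← zpow_add, add_comm, zpow_add, IsometryEquiv.mul_apply,
    IsometryEquiv.dist_eq]

theorem zpow_mem_qcHull {φ : X ≃ᵢ X} {C : ℝ} {x : X} (hx : x ∈ qcHull φ C) (n : ℤ) :
    (φ ^ n) x ∈ qcHull φ C := by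
  obtain ⟨p, hp, q, hq, s, hs, hxs⟩ := hx
  exact ⟨_, zpow_mem_almostFixedSet hp n, _, zpow_mem_almostFixedSet hq n, _,
    hs.image (φ ^ n), Set.mem_image_of_mem _ hxs⟩

theorem almostFixedSet_subset_qcHull (hX : IsGeodesicSpace X) (φ : X ≃ᵢ X) (C : ℝ) :
    almostFixedSet φ C ⊆ qcHull φ C := by
  intro x hx
  obtain ⟨s, hs⟩ := hX x x
  refine ⟨x, hx, x, hx, s, hs, ?_⟩
  obtain ⟨γ, ⟨h0, -, -⟩, rfl⟩ := hs
  exact ⟨0, ⟨le_rfl, dist_nonneg⟩, h0⟩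

/-- The distance from a point to a geodesic segment is controlled by a Gromov product. -/
theorem IsGeodSegment.exists_dist_le {δ : ℝ} (hyp : IsGromovHyperbolic X δ) {s : Set X} {p q : X}
    (hs : IsGeodSegment s p q) (z : X) : ∃ w ∈ s, dist z w ≤ gromovProd z p q + 2 * δ := by
  have h1 := dist_triangle z p q
  have h2 := dist_triangle p z q
  have h3 := dist_triangle z q p
  have c1 := dist_comm z p
  have c2 := dist_comm q p
  obtain ⟨w, hw, h4, h5⟩ := hs.exists_dist_eq (t := (dist p z + dist p q - dist z q) / 2)
    (by linarith) (by linarith)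
  refine ⟨w, hw, ?_⟩
  have c3 := dist_comm w q
  simp only [gromovProd]
  rcases hyp.four_point z p q w with h | h <;> linarith

/-- An endpoint lying between `p` and `q` can be replaced by one of `p`, `q`. -/
theorem IsGromovHyperbolic.exists_gromovProd_le {δ : ℝ} (hyp : IsGromovHyperbolic X δ)
    {a p q : X} (ha : dist p a + dist a q = dist p q) (w z : X) :
    ∃ r, (r = p ∨ r = q) ∧ gromovProd z r w ≤ gromovProd z a w + δ := by
  have c1 := dist_comm p a
  have c2 := dist_comm w q
  rcases hyp.four_point a p q w with h | h
  · refine ⟨p, .inl rfl, ?_⟩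
    simp only [gromovProd]
    linarith [dist_triangle z a p]
  · refine ⟨q, .inr rfl, ?_⟩
    simp only [gromovProd]
    linarith [dist_triangle z a q]

theorem exists_mem_qcHull_dist_le {δ C : ℝ} (hX : IsGeodesicSpace X)
    (hyp : IsGromovHyperbolic X δ) {φ : X ≃ᵢ X} {a y z : X} (ha : a ∈ qcHull φ C)
    (hy : y ∈ qcHull φ C) (hz : dist a z + dist z y = dist a y) :
    ∃ w ∈ qcHull φ C, dist z w ≤ 4 * δ := by
  obtain ⟨p, hp, q, hq, s, hs, has⟩ := ha
  obtain ⟨p', hp', q', hq', s', hs', hys⟩ := hy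
  obtain ⟨r, hr, hr1⟩ := hyp.exists_gromovProd_le (hs.dist_add_dist has) y z
  obtain ⟨r', hr', hr1'⟩ := hyp.exists_gromovProd_le (hs'.dist_add_dist hys) r z
  have hrF : r ∈ almostFixedSet φ C := by rcases hr with rfl | rfl <;> assumption
  have hrF' : r' ∈ almostFixedSet φ C := by rcases hr' with rfl | rfl <;> assumption
  obtain ⟨σ, hσ⟩ := hX r' r
  obtain ⟨w, hw, hzw⟩ := hσ.exists_dist_le hyp z
  refine ⟨w, ⟨r', hrF', r, hrF, σ, hσ, hw⟩, ?_⟩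
  have c1 := dist_comm a z
  have c2 := dist_comm y r
  simp only [gromovProd] at *
  linarith

/-- Almost nearest point projections to the hull. -/
theorem gromovProd_le_of_almost_nearest {δ C ε : ℝ} (hX : IsGeodesicSpace X)
    (hyp : IsGromovHyperbolic X δ) {φ : X ≃ᵢ X} {m a : X} (ha : a ∈ qcHull φ C)
    (hm : ∀ w ∈ qcHull φ C, dist m a - ε ≤ dist m w) {y : X} (hy : y ∈ qcHull φ C) :
    gromovProd a m y ≤ 6 * δ + ε := by
  obtain ⟨s, hs⟩ := hX a y
  have c1 := dist_comm m a
  have c2 := dist_comm y m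
  have c3 := dist_comm y a
  obtain ⟨z, hz, hz1, hz2⟩ := hs.exists_dist_eq (t := gromovProd a m y)
    (by simp only [gromovProd]; linarith [dist_triangle m a y])
    (by simp only [gromovProd]; linarith [dist_triangle a y m])
  obtain ⟨w, hw, hzw⟩ := exists_mem_qcHull_dist_le hX hyp ha hy (hs.dist_add_dist hz)
  have h1 := hm w hw
  have h2 := dist_triangle m z w
  have c4 := dist_comm z y
  simp only [gromovProd] at *
  rcases hyp.four_point m a y z with h | h <;> linarith

/-- The ping-pong step: points on the far side of `m` are sent to the near side by all nontrivial
powers of `φ`. -/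
theorem gromovProd_zpow_ge {δ ε : ℝ} (hX : IsGeodesicSpace X)
    (hyp : IsGromovHyperbolic X δ) (hε : 0 < ε) (hδε : δ ≤ ε) {φ : X ≃ᵢ X} {a b m : X}
    (ha : a ∈ qcHull φ (100 * ε)) (hb : ∀ w ∈ qcHull φ (100 * ε), dist b a - ε ≤ dist b w)
    (hm : dist m a + dist m b = dist a b) (hma : 20 * ε ≤ dist m a)
    {x : X} (hx : 2 * ε ≤ gromovProd m x b) {n : ℤ} (hn : n ≠ 0) :
    2 * ε ≤ gromovProd m ((φ ^ n) x) a := by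
  set g := φ ^ n with hg
  have cab := dist_comm a b
  have cma := dist_comm m a
  have cmb := dist_comm m b
  have cxa := dist_comm x a
  have cxm := dist_comm x m
  have hmw : ∀ w ∈ qcHull φ (100 * ε), dist m a - ε ≤ dist m w := fun w hw => by
    linarith [hb w hw, dist_triangle b m w]
  have hxa : gromovProd m x a ≤ ε := by
    simp only [gromovProd] at *
    rcases hyp.four_point m a b x with h | h <;> linarith
  have hxy : ∀ y ∈ qcHull φ (100 * ε), gromovProd a x y ≤ 8 * ε := fun y hy => by
    have h1 := gromovProd_le_of_almost_nearest hX hyp ha hmw hy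
    simp only [gromovProd] at *
    rcases hyp.four_point a m y x with h | h <;> linarith
  have hga : g a ∈ qcHull φ (100 * ε) := zpow_mem_qcHull ha n
  have hga' : (φ ^ (-n)) a ∈ qcHull φ (100 * ε) := zpow_mem_qcHull ha (-n)
  have hgg : g ((φ ^ (-n)) a) = a := by
    rw [hg, zpow_neg, IsometryEquiv.apply_inv_self]
  have h1 := hxy _ hga
  have h2 : gromovProd (g a) (g x) a ≤ 8 * ε := by
    have := hxy _ hga'
    rw [← hgg]
    nth_rw 1 [hgg]
    simpa only [gromovProd, g.dist_eq] using this
  have hdisp : 21 * ε ≤ dist a (g a) := by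
    obtain ⟨s, hs⟩ := hX a m
    obtain ⟨y, hy, hy1, hy2⟩ := hs.exists_dist_eq (t := 2 * ε) (by linarith) (by linarith)
    have hyF : y ∉ almostFixedSet φ (100 * ε) := fun hyF => by
      have := hb y (almostFixedSet_subset_qcHull hX _ _ hyF)
      linarith [dist_triangle b m y, dist_comm m y]
    have hyg : 100 * ε < dist y (g y) := not_le.1 fun h => hyF ⟨n, hn, h⟩
    linarith [dist_triangle4 y a (g a) (g y), dist_comm y a, g.dist_eq a y]
  have h3 : gromovProd a x (g x) ≤ 9 * ε := by
    have c1 := dist_comm (g a) a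
    have c2 := dist_comm (g a) (g x)
    have c3 := dist_comm (g x) a
    have c4 := dist_comm (g a) x
    simp only [gromovProd] at *
    rcases hyp.four_point a x (g a) (g x) with h | h <;> linarith
  have c3 := dist_comm (g x) a
  have c4 := dist_comm (g x) m
  have c5 := dist_comm (g x) x
  simp only [gromovProd] at *
  rcases hyp.four_point a x (g x) m with h | h <;> linarith

theorem exists_almost_nearest_pair {A B : Set X} (hA : A.Nonempty) (hB : B.Nonempty) {ε : ℝ}
    (hε : 0 < ε) :
    ∃ a ∈ A, ∃ b ∈ B, setDist A B ≤ dist a b ∧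
      ∀ a' ∈ A, ∀ b' ∈ B, dist a b - ε ≤ dist a' b' := by
  have hbdd : BddBelow (Set.image2 dist A B) :=
    ⟨0, by rintro _ ⟨a, -, b, -, rfl⟩; exact dist_nonneg⟩
  obtain ⟨_, ⟨a, ha, b, hb, rfl⟩, hab⟩ :=
    Real.lt_sInf_add_pos (hA.image2 hB (f := dist)) hε
  refine ⟨a, ha, b, hb, csInf_le hbdd ⟨a, ha, b, hb, rfl⟩, fun a' ha' b' hb' => ?_⟩
  linarith [csInf_le hbdd (Set.mem_image2_of_mem ha' hb')]

end Hyperbolic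

/-- if the quasiconvex hulls of the almost fixed sets of two isometries of a
δ-hyperbolic geodesic space have diameter at most `C'` and are at distance at least `C₁`
(a constant depending only on δ, C, C'), then `φ₁, φ₂` generate a free group of rank 2:
the natural map from the free group on two generators is injective. -/
theorem free_group_from_far_twists (δ C C' : ℝ) (hδ : 0 ≤ δ) (hC : 100 * δ < C)
    (hC' : 0 ≤ C') :
    ∃ C₁ : ℝ, ∀ (X : Type*) [MetricSpace X],
      IsGeodesicSpace X → IsGromovHyperbolic X δ →
      ∀ φ₁ φ₂ : X ≃ᵢ X,
        (almostFixedSet φ₁ C).Nonempty → (almostFixedSet φ₂ C).Nonempty →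
        Metric.diam (qcHull φ₁ C) ≤ C' → Metric.diam (qcHull φ₂ C) ≤ C' →
        C₁ ≤ setDist (qcHull φ₁ C) (qcHull φ₂ C) →
        Function.Injective
          (FreeGroup.lift (fun i : Fin 2 => if i = 0 then φ₁ else φ₂) :
            FreeGroup (Fin 2) →* (X ≃ᵢ X)) := by
  refine ⟨C, fun X _ hX hyp φ₁ φ₂ hne₁ hne₂ _ _ hdist => ?_⟩
  obtain ⟨ε, rfl⟩ : ∃ ε, C = 100 * ε := ⟨C / 100, by ring⟩
  have hδε : δ ≤ ε := by linarith
  have hε : 0 < ε := by linarith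
  obtain ⟨a, ha, b, hb, hab, hmin⟩ := exists_almost_nearest_pair
    (hne₁.mono (almostFixedSet_subset_qcHull hX φ₁ _))
    (hne₂.mono (almostFixedSet_subset_qcHull hX φ₂ _)) hε
  obtain ⟨s, hs⟩ := hX a b
  obtain ⟨m, -, hm₁, hm₂⟩ := hs.exists_dist_eq (t := dist a b / 2) (by positivity)
    (by linarith [dist_nonneg (x := a) (y := b)])
  rw [dist_comm] at hm₁
  let _ : MulAction (X ≃ᵢ X) X :=
    { smul := fun g x => g x, one_smul := fun _ => rfl, mul_smul := fun _ _ _ => rfl }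
  let c : Fin 2 → X := ![a, b]
  have hdisj : ∀ x, 2 * ε ≤ gromovProd m x a → 2 * ε ≤ gromovProd m x b → False := by
    intro x h₁ h₂
    simp only [gromovProd] at h₁ h₂
    rcases hyp.four_point m a b x with h | h <;> linarith [dist_comm x a]
  refine FreeGroup.injective_lift_of_zpow_ping_pong _
    (fun i => {x | 2 * ε ≤ gromovProd m x (c i)}) ?_ ?_ ?_
  · refine fun i => ⟨c i, ?_⟩
    fin_cases i <;> simp [c, gromovProd] <;> linarith
  · intro i j hij
    refine Set.disjoint_left.2 fun x hi hj => ?_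
    fin_cases i <;> fin_cases j <;>
      first | exact hij rfl | exact hdisj x hi hj | exact hdisj x hj hi
  · intro i j hij n hn x hx
    fin_cases i <;> fin_cases j
    · exact (hij rfl).elim
    · exact gromovProd_zpow_ge (b := b) hX hyp hε hδε ha
        (fun w hw => by linarith [hmin w hw b hb, dist_comm a b, dist_comm b w])
        (by linarith) (by linarith) hx hn
    · exact gromovProd_zpow_ge (b := a) hX hyp hε hδε hb
        (fun w hw => hmin a ha w hw)
        (by linarith [dist_comm a b]) (by linarith) hx hn
    · exact (hij rfl).elim
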